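/- Let U ⊆ C^{l1}×...×C^{ln} be open, K ⊆ U compact, and let r := dist(K, complement of U) (with respect to the sup-norm). Then for any a in the C^n-holomorphically convex hull K̂ of K and any f ∈ O_{l1,...,ln}(U), there exists g ∈ O_{l1,...,ln}(B(a,r)) on the open sup-norm ball B(a,r) of radius r around a such that all partial derivatives of f and g of all orders agree at a (equivalently, the Taylor series of f at a converges on B(a,r) to a C^n-holomorphic function). -/

import Mathlib

open Set Metric

/-- `f : ℂ^{l 0} × ... × ℂ^{l (n-1)} → ℂ^n` is `ℂⁿ`-holomorphic on `U`:
holomorphic, and for `i ≠ j` the partial derivative of the `i`-th component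
in every direction of the `j`-th coordinate block vanishes. -/
def CnHolo {n : ℕ} {l : Fin n → ℕ} (U : Set (∀ j, Fin (l j) → ℂ))
    (f : (∀ j, Fin (l j) → ℂ) → (Fin n → ℂ)) : Prop :=
  DifferentiableOn ℂ f U ∧
    ∀ a ∈ U, ∀ i j : Fin n, i ≠ j → ∀ v : Fin (l j) → ℂ,
      fderiv ℂ (fun z => f z i) a (Pi.single j v) = 0

/-- The `ℂⁿ`-holomorphically convex hull of `K` in `U` (sup-norms throughout). -/
def cnHull {n : ℕ} {l : Fin n → ℕ} (U K : Set (∀ j, Fin (l j) → ℂ)) :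
    Set (∀ j, Fin (l j) → ℂ) :=
  {z ∈ U | ∀ f, CnHolo U f → ‖f z‖ ≤ sSup ((fun w => ‖f w‖) '' K)}

open Filter Topology

section HolomorphicBasics

variable {E F : Type*} [NormedAddCommGroup E] [NormedSpace ℂ E]
  [NormedAddCommGroup F] [NormedSpace ℂ F] [CompleteSpace F]

/-- **Weierstrass' theorem** on normed spaces: a uniform limit of holomorphic functions
on a ball is complex differentiable at the centre. -/
theorem TendstoUniformlyOn.differentiableAt_of_ball {ι : Type*} {p : Filter ι} [p.NeBot]
    {f : ι → E → F} {g : E → F} {z : E} {r : ℝ} (hr : 0 < r)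
    (hf : ∀ᶠ n in p, DifferentiableOn ℂ (f n) (ball z r))
    (hfg : TendstoUniformlyOn f g p (ball z r)) : DifferentiableAt ℂ g z := by
  have hr2 : 0 < r / 2 := half_pos hr
  have hsub : ∀ x ∈ ball z (r / 2), ball x (r / 2) ⊆ ball z r := fun x hx ↦
    ball_subset_ball' (by rw [mem_ball] at hx; linarith)
  have hdiff : ∀ᶠ n in p, ∀ x ∈ ball z (r / 2), DifferentiableAt ℂ (f n) x := by
    filter_upwards [hf] with n hn x hx
    exact hn.differentiableAt (isOpen_ball.mem_nhds (ball_subset_ball (by linarith) hx))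
  have hcauchy : UniformCauchySeqOn (fun n x ↦ fderiv ℂ (f n) x) p (ball z (r / 2)) := by
    intro u hu
    obtain ⟨ε, hε, hεu⟩ := Metric.mem_uniformity_dist.mp hu
    have hC := hfg.uniformCauchySeqOn
      {q : F × F | dist q.1 q.2 < ε * r / 16} (Metric.dist_mem_uniformity (by positivity))
    filter_upwards [hC, hf.prod_mk hf, hdiff.prod_mk hdiff] with n hn hd hd' x hx
    apply hεu
    rw [dist_eq_norm, ← fderiv_fun_sub (hd'.1 x hx) (hd'.2 x hx)]
    have hb : ∀ y ∈ ball x (r / 2), ‖f n.1 y - f n.2 y‖ < ε * r / 16 := fun y hy ↦ by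
      rw [← dist_eq_norm]; exact hn y (hsub x hx hy)
    have := Complex.norm_fderiv_le_div_of_mapsTo_ball (f := fun y ↦ f n.1 y - f n.2 y) (c := x)
      (R₁ := r / 2) (R₂ := ε * r / 8) ((hd.1.sub hd.2).mono (hsub x hx)) (fun y hy ↦ by
        rw [mem_closedBall, dist_eq_norm]
        have h1 := norm_sub_le (f n.1 y - f n.2 y) (f n.1 x - f n.2 x)
        have h2 := hb y hy
        have h3 := hb x (mem_ball_self hr2)
        linarith) hr2
    refine this.trans_lt ?_
    rw [div_lt_iff₀ hr2]
    nlinarith [mul_pos hε hr]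
  have hlim : ∀ x ∈ ball z (r / 2), ∃ L, Tendsto (fun n ↦ fderiv ℂ (f n) x) p (𝓝 L) :=
    fun x hx ↦ cauchy_map_iff_exists_tendsto.mp (hcauchy.cauchy_map hx)
  choose! g' hg' using hlim
  have hunif := hcauchy.tendstoUniformlyOn_of_tendsto hg'
  have hmem : ball z (r / 2) ∈ 𝓝 z := ball_mem_nhds z hr2
  refine (hasFDerivAt_of_tendstoUniformlyOnFilter (l := p) (f := f)
    (f' := fun n x ↦ fderiv ℂ (f n) x) (g' := g') ?_ ?_ ?_).differentiableAt
  · exact (tendstoUniformlyOn_iff_tendstoUniformlyOnFilter.mp hunif).mono_right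
      (le_principal_iff.mpr hmem)
  · filter_upwards [hdiff.prod_mk hmem] with n hn
    exact (hn.1 n.2 hn.2).hasFDerivAt
  · filter_upwards [hmem] with y hy
    exact hfg.tendsto_at (ball_subset_ball (by linarith) hy)

theorem differentiableOn_fderiv_apply {U : Set E} (hU : IsOpen U) {f : E → F}
    (hf : DifferentiableOn ℂ f U) (v : E) :
    DifferentiableOn ℂ (fun z ↦ fderiv ℂ f z v) U := by
  intro z₀ hz₀
  refine DifferentiableAt.differentiableWithinAt ?_
  obtain ⟨M, ε, hε, hM⟩ : ∃ M ε : ℝ, 0 < ε ∧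
      ∀ y ∈ ball z₀ (2 * ε), y ∈ U ∧ ‖f y‖ ≤ M := by
    have hc : ContinuousAt f z₀ := (hf.differentiableAt (hU.mem_nhds hz₀)).continuousAt
    have h1 : ∀ᶠ y in 𝓝 z₀, ‖f y‖ < ‖f z₀‖ + 1 :=
      hc.norm.eventually_lt continuousAt_const (by linarith)
    obtain ⟨δ, hδ, h⟩ := Metric.eventually_nhds_iff_ball.mp ((hU.eventually_mem hz₀).and h1)
    refine ⟨‖f z₀‖ + 1, δ / 2, by positivity, fun y hy ↦ ?_⟩
    have := h y (by rwa [mul_div_cancel₀ _ two_ne_zero] at hy)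
    exact ⟨this.1, this.2.le⟩
  obtain ⟨R, hR, hRv⟩ : ∃ R : ℝ, 0 < R ∧ ∀ s : ℂ, ‖s‖ < R → ‖s • v‖ < ε := by
    refine ⟨ε / (‖v‖ + 1), by positivity, fun s hs ↦ ?_⟩
    rw [lt_div_iff₀ (by positivity)] at hs
    rw [norm_smul]
    nlinarith [norm_nonneg s]
  have hmem : ∀ z ∈ ball z₀ ε, ∀ s ∈ ball (0 : ℂ) R, z + s • v ∈ ball z₀ (2 * ε) := by
    intro z hz s hs
    rw [mem_ball, dist_eq_norm] at hz ⊢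
    have h1 := hRv s (by simpa using hs)
    have h2 := norm_add_le (z - z₀) (s • v)
    rw [show z + s • v - z₀ = z - z₀ + s • v by abel]
    linarith
  have hline : ∀ z ∈ ball z₀ ε,
      DifferentiableOn ℂ (fun s : ℂ ↦ f (z + s • v)) (ball 0 R) := fun z hz ↦
    hf.comp (t := U) (by fun_prop) fun s hs ↦ (hM _ (hmem z hz s hs)).1
  have hderiv : ∀ z ∈ ball z₀ ε, dslope (fun s : ℂ ↦ f (z + s • v)) 0 0 = fderiv ℂ f z v := by
    intro z hz
    have hz' : z ∈ U := (hM z (ball_subset_ball (by linarith) hz)).1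
    have h1 : HasFDerivAt f (fderiv ℂ f z) (z + (0 : ℂ) • v) := by
      simpa using (hf.differentiableAt (hU.mem_nhds hz')).hasFDerivAt
    have h2 : HasDerivAt (fun s : ℂ ↦ z + s • v) v 0 := by
      simpa using ((hasDerivAt_id (0 : ℂ)).smul_const v).const_add z
    rw [dslope_same]
    exact (h1.comp_hasDerivAt (0 : ℂ) h2).deriv
  have hlip : ∀ z ∈ ball z₀ ε, ∀ h ∈ ball (0 : ℂ) R,
      dist (fderiv ℂ f z v) (dslope (fun s : ℂ ↦ f (z + s • v)) 0 h)
        ≤ (2 * (2 * M / R)) / R * ‖h‖ := by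
    intro z hz h hh
    have hb : ∀ s ∈ ball (0 : ℂ) R, ‖dslope (fun s : ℂ ↦ f (z + s • v)) 0 s‖ ≤ 2 * M / R :=
      fun s hs ↦ Complex.norm_dslope_le_div_of_mapsTo_ball (hline z hz) (fun t ht ↦ by
        rw [mem_closedBall, dist_eq_norm]
        have h1 := (hM _ (hmem z hz t ht)).2
        have h2 := (hM _ (hmem z hz 0 (mem_ball_self hR))).2
        have h3 := norm_sub_le (f (z + t • v)) (f (z + (0 : ℂ) • v))
        linarith) hs
    have hd : DifferentiableOn ℂ (dslope (fun s : ℂ ↦ f (z + s • v)) 0) (ball 0 R) :=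
      (Complex.differentiableOn_dslope (ball_mem_nhds 0 hR)).mpr (hline z hz)
    rw [← hderiv z hz, ← dist_zero_right h, dist_comm]
    refine Complex.dist_le_div_mul_dist_of_mapsTo_ball hd (fun t ht ↦ ?_) hh
    rw [mem_closedBall, dist_eq_norm]
    have h1 := hb t ht
    have h2 := hb 0 (mem_ball_self hR)
    have h3 := norm_sub_le (dslope (fun s : ℂ ↦ f (z + s • v)) 0 t)
      (dslope (fun s : ℂ ↦ f (z + s • v)) 0 0)
    linarith
  have hball : ∀ᶠ h in 𝓝[≠] (0 : ℂ), h ∈ ball (0 : ℂ) R :=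
    mem_nhdsWithin_of_mem_nhds (ball_mem_nhds 0 hR)
  refine TendstoUniformlyOn.differentiableAt_of_ball (p := 𝓝[≠] (0 : ℂ))
    (f := fun h z ↦ dslope (fun s : ℂ ↦ f (z + s • v)) 0 h) hε ?_ ?_
  · filter_upwards [hball, self_mem_nhdsWithin] with h hh hne
    have hne' : h ≠ 0 := hne
    simp only [dslope_of_ne _ hne', slope_def_module, sub_zero, zero_smul, add_zero]
    refine DifferentiableOn.const_smul (DifferentiableOn.sub ?_ ?_) _
    · exact hf.comp (t := U) (by fun_prop) fun z hz ↦ (hM _ (hmem z hz h hh)).1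
    · exact hf.mono fun z hz ↦ (hM z (ball_subset_ball (by linarith) hz)).1
  · rw [Metric.tendstoUniformlyOn_iff]
    intro η hη
    have ht : Tendsto (fun h : ℂ ↦ (2 * (2 * M / R)) / R * ‖h‖) (𝓝[≠] 0) (𝓝 0) := by
      have : Tendsto (fun h : ℂ ↦ (2 * (2 * M / R)) / R * ‖h‖) (𝓝 0)
          (𝓝 ((2 * (2 * M / R)) / R * ‖(0 : ℂ)‖)) := by
        exact (Continuous.tendsto (by fun_prop) 0)
      rw [norm_zero, mul_zero] at this
      exact this.mono_left nhdsWithin_le_nhds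
    filter_upwards [hball, ht.eventually_lt_const hη] with h hh hlt z hz
    exact (hlip z hz h hh).trans_lt hlt

theorem differentiableOn_iteratedDeriv_snd {W : Set (E × ℂ)} (hW : IsOpen W)
    {f : E × ℂ → F} (hf : DifferentiableOn ℂ f W) (m : ℕ) :
    DifferentiableOn ℂ (fun p : E × ℂ ↦ iteratedDeriv m (fun s ↦ f (p.1, s)) p.2) W := by
  induction m with
  | zero => simpa using hf
  | succ m ih =>
    refine (differentiableOn_fderiv_apply hW ih (0, 1)).congr fun p hp ↦ ?_
    have h1 := (ih.differentiableAt (hW.mem_nhds hp)).hasFDerivAt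
    have h2 : HasDerivAt (fun s : ℂ ↦ (p.1, s)) ((0 : E), (1 : ℂ)) p.2 :=
      (hasDerivAt_const _ _).prodMk (hasDerivAt_id _)
    rw [iteratedDeriv_succ]
    exact (HasFDerivAt.comp_hasDerivAt (f := fun s : ℂ ↦ (p.1, s)) p.2 h1 h2).deriv

/-- The homogeneous part of degree `m` of the Taylor expansion of `f` at `z`,
evaluated at `v`. -/
noncomputable def taylorTerm (f : E → F) (m : ℕ) (z v : E) : F :=
  (m.factorial : ℂ)⁻¹ • iteratedDeriv m (fun s : ℂ ↦ f (z + s • v)) 0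

theorem differentiableOn_taylorTerm_left {U : Set E} (hU : IsOpen U) {f : E → F}
    (hf : DifferentiableOn ℂ f U) (m : ℕ) (v : E) :
    DifferentiableOn ℂ (fun z ↦ taylorTerm f m z v) U := by
  have hcont : Continuous fun p : E × ℂ ↦ p.1 + p.2 • v := by fun_prop
  have h := differentiableOn_iteratedDeriv_snd (f := fun p : E × ℂ ↦ f (p.1 + p.2 • v))
    (hU.preimage hcont) (hf.comp (t := U) (by fun_prop) fun p hp ↦ hp) m
  exact (h.comp (f := fun z : E ↦ (z, (0 : ℂ))) (s := U) (by fun_prop)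
    fun z hz ↦ by simpa using hz).const_smul _

theorem differentiable_taylorTerm_right {U : Set E} (hU : IsOpen U) {f : E → F}
    (hf : DifferentiableOn ℂ f U) (m : ℕ) {z : E} (hz : z ∈ U) :
    Differentiable ℂ (taylorTerm f m z) := by
  have hcont : Continuous fun p : E × ℂ ↦ z + p.2 • p.1 := by fun_prop
  have h := differentiableOn_iteratedDeriv_snd (f := fun p : E × ℂ ↦ f (z + p.2 • p.1))
    (hU.preimage hcont) (hf.comp (t := U) (by fun_prop) fun p hp ↦ hp) m
  rw [← differentiableOn_univ]
  exact (h.comp (f := fun v : E ↦ (v, (0 : ℂ))) (s := univ) (by fun_prop)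
    fun v _ ↦ by simpa using hz).const_smul _

/-- **Cauchy's estimate** for the homogeneous parts of the Taylor expansion. -/
theorem norm_taylorTerm_le {f : E → F} {z v : E} {ρ t M : ℝ} (hρ : 0 < ρ) (hρt : ρ < t)
    (hf : ∀ y ∈ closedBall z t, DifferentiableAt ℂ f y) (hM : ∀ y ∈ closedBall z t, ‖f y‖ ≤ M)
    (hv : ‖v‖ < ρ) (m : ℕ) : ‖taylorTerm f m z v‖ ≤ M * (ρ / t) ^ m := by
  have ht : 0 < t := hρ.trans hρt
  have hmem : ∀ s ∈ closedBall (0 : ℂ) (t / ρ), z + s • v ∈ closedBall z t := by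
    intro s hs
    rw [mem_closedBall_zero_iff, le_div_iff₀ hρ] at hs
    rw [mem_closedBall, dist_eq_norm, add_sub_cancel_left, norm_smul]
    nlinarith [norm_nonneg s]
  have hd : DiffContOnCl ℂ (fun s : ℂ ↦ f (z + s • v)) (ball 0 (t / ρ)) := by
    refine DifferentiableOn.diffContOnCl_ball (U := closedBall 0 (t / ρ)) ?_ le_rfl
    intro s hs
    exact ((hf _ (hmem s hs)).comp s (by fun_prop)).differentiableWithinAt
  have h := Complex.norm_iteratedDeriv_le_of_forall_mem_sphere_norm_le m (div_pos ht hρ) hd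
    fun s hs ↦ hM _ (hmem s (sphere_subset_closedBall hs))
  have hfac : (0 : ℝ) < m.factorial := by positivity
  rw [taylorTerm, norm_smul, norm_inv, Complex.norm_natCast]
  calc _ ≤ (m.factorial : ℝ)⁻¹ * (m.factorial * M / (t / ρ) ^ m) := by gcongr
    _ = M * (ρ / t) ^ m := by
      rw [div_pow, div_pow]
      field_simp

theorem hasSum_taylorTerm {f : E → F} {a z : E} {δ : ℝ}
    (hf : DifferentiableOn ℂ f (ball a δ)) (hz : z ∈ ball a δ) :
    HasSum (fun m ↦ taylorTerm f m a (z - a)) (f z) := by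
  obtain ⟨ρ, hzρ, hρδ⟩ := exists_between (mem_ball.mp hz)
  rw [dist_eq_norm] at hzρ
  have hρ : 0 < ρ := (norm_nonneg _).trans_lt hzρ
  have hd : DifferentiableOn ℂ (fun s : ℂ ↦ f (a + s • (z - a))) (ball 0 (δ / ρ)) := by
    refine hf.comp (t := ball a δ) (by fun_prop) fun s hs ↦ ?_
    rw [mem_ball_zero_iff, lt_div_iff₀ hρ] at hs
    rw [mem_ball, dist_eq_norm, add_sub_cancel_left, norm_smul]
    nlinarith [norm_nonneg s]
  have h := Complex.hasSum_taylorSeries_on_ball hd (z := 1)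
    (by rw [mem_ball_zero_iff, norm_one, lt_div_iff₀ hρ]; linarith)
  simpa [taylorTerm] using h

end HolomorphicBasics

theorem fderiv_apply_eq_zero_of_eventually_eq {E F : Type*} [NormedAddCommGroup E]
    [NormedSpace ℂ E] [NormedAddCommGroup F] [NormedSpace ℂ F] {h : E → F} {a v : E}
    (hd : DifferentiableAt ℂ h a) (hc : ∀ᶠ τ : ℂ in 𝓝 0, h (a + τ • v) = h a) :
    fderiv ℂ h a v = 0 := by
  have hc' : (fun τ : ℂ ↦ h (a + τ • v)) =ᶠ[𝓝 0] fun _ ↦ h a := hc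
  rw [← hd.lineDeriv_eq_fderiv, lineDeriv, hc'.deriv_eq, deriv_const]

theorem taylorTerm_pi_apply {E ι : Type*} [NormedAddCommGroup E] [NormedSpace ℂ E] [Fintype ι]
    {U : Set E} (hU : IsOpen U) {f : E → ι → ℂ} (hf : DifferentiableOn ℂ f U) (m : ℕ) {z : E}
    (hz : z ∈ U) (v : E) (i : ι) :
    taylorTerm f m z v i = taylorTerm (fun y ↦ f y i) m z v := by
  have hcont : Continuous fun s : ℂ ↦ z + s • v := by fun_prop
  have hline : DifferentiableOn ℂ (fun s : ℂ ↦ f (z + s • v)) ((fun s : ℂ ↦ z + s • v) ⁻¹' U) :=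
    hf.comp (t := U) (by fun_prop) fun s hs ↦ hs
  have hsmooth : ContDiffAt ℂ m (fun s : ℂ ↦ f (z + s • v)) 0 :=
    (hline.contDiffOn (hU.preimage hcont)).contDiffAt
      ((hU.preimage hcont).mem_nhds (by simpa using hz))
  have h := (ContinuousLinearMap.proj (R := ℂ) (φ := fun _ : ι ↦ ℂ) i).iteratedFDeriv_comp_left
    hsmooth (i := m) le_rfl
  have h' := congrArg (fun L ↦ L fun _ ↦ (1 : ℂ)) h
  simp only [taylorTerm, Pi.smul_apply, iteratedDeriv_eq_iteratedFDeriv]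
  exact congrArg _ h'.symm

namespace CnHolo

variable {n : ℕ} {l : Fin n → ℕ} {U : Set (∀ j, Fin (l j) → ℂ)}
  {f : (∀ j, Fin (l j) → ℂ) → (Fin n → ℂ)}

theorem apply_add_single (hU : IsOpen U) (hf : CnHolo U f) {z : ∀ j, Fin (l j) → ℂ} {δ : ℝ}
    (hz : ball z δ ⊆ U) {i j : Fin n} (hij : i ≠ j) {p : ∀ j, Fin (l j) → ℂ}
    {w : Fin (l j) → ℂ} (hp : p ∈ ball z δ) (hpw : p + Pi.single j w ∈ ball z δ) :
    f (p + Pi.single j w) i = f p i := by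
  set L : ℂ → ∀ j, Fin (l j) → ℂ := fun τ ↦ p + τ • (Pi.single j w : ∀ j, Fin (l j) → ℂ) with hL
  have hLd : ∀ τ, HasDerivAt L (Pi.single j w) τ := fun τ ↦ by
    have h := ((hasDerivAt_id τ).smul_const (Pi.single j w : ∀ j, Fin (l j) → ℂ)).const_add p
    rwa [one_smul] at h
  have hopen : IsOpen (L ⁻¹' ball z δ) := isOpen_ball.preimage (by fun_prop)
  have hconv : Convex ℝ (L ⁻¹' ball z δ) := by
    intro x hx y hy s t hs ht hst
    have hcomb : L (s • x + t • y) = s • L x + t • L y := by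
      simp only [hL, add_smul, smul_add, smul_assoc]
      rw [add_add_add_comm, ← add_smul, hst, one_smul]
    rw [mem_preimage, hcomb]
    exact convex_ball z δ hx hy hs ht hst
  have hderiv : ∀ τ ∈ L ⁻¹' ball z δ, HasDerivAt (fun τ ↦ f (L τ) i) 0 τ := by
    intro τ hτ
    have hd : DifferentiableAt ℂ (fun y ↦ f y i) (L τ) :=
      differentiableAt_pi.mp (hf.1.differentiableAt (hU.mem_nhds (hz hτ))) i
    rw [← hf.2 (L τ) (hz hτ) i j hij w]
    exact hd.hasFDerivAt.comp_hasDerivAt τ (hLd τ)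
  have h := hopen.is_const_of_deriv_eq_zero hconv.isPreconnected
    (fun τ hτ ↦ (hderiv τ hτ).differentiableAt.differentiableWithinAt)
    (fun τ hτ ↦ (hderiv τ hτ).deriv) (x := 1) (y := 0)
    (by simpa [hL] using hpw) (by simpa [hL] using hp)
  simpa [hL] using h

theorem taylorTerm_add_single_right (hU : IsOpen U) (hf : CnHolo U f) (m : ℕ)
    {z : ∀ j, Fin (l j) → ℂ} (hz : z ∈ U) (v : ∀ j, Fin (l j) → ℂ) {i j : Fin n} (hij : i ≠ j)
    (w : Fin (l j) → ℂ) :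
    taylorTerm f m z (v + Pi.single j w) i = taylorTerm f m z v i := by
  obtain ⟨δ, hδ, hball⟩ := Metric.isOpen_iff.mp hU z hz
  have hnear : ∀ u : ∀ j, Fin (l j) → ℂ, ∀ᶠ s : ℂ in 𝓝 0, z + s • u ∈ ball z δ := fun u ↦
    (Continuous.tendsto (by fun_prop : Continuous fun s : ℂ ↦ z + s • u) 0).eventually
      (isOpen_ball.eventually_mem (by simpa using hδ))
  rw [taylorTerm_pi_apply hU hf.1 m hz, taylorTerm_pi_apply hU hf.1 m hz, taylorTerm, taylorTerm]
  congr 1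
  refine Filter.EventuallyEq.iteratedDeriv_eq m ?_
  filter_upwards [hnear v, hnear (v + Pi.single j w)] with s h1 h2
  rw [smul_add, ← add_assoc, ← Pi.single_smul] at h2 ⊢
  exact hf.apply_add_single hU hball hij h1 h2

theorem taylorTerm_left (hU : IsOpen U) (hf : CnHolo U f) (m : ℕ) (v : ∀ j, Fin (l j) → ℂ) :
    CnHolo U fun z ↦ taylorTerm f m z v := by
  have hdiff := differentiableOn_taylorTerm_left hU hf.1 m v
  refine ⟨hdiff, fun a ha i j hij w ↦ ?_⟩
  refine fderiv_apply_eq_zero_of_eventually_eq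
    (differentiableAt_pi.mp (hdiff.differentiableAt (hU.mem_nhds ha)) i) ?_
  obtain ⟨δ, hδ, hball⟩ := Metric.isOpen_iff.mp hU a ha
  have hshift : ∀ b ∈ ball a δ, ∀ u : ∀ j, Fin (l j) → ℂ, ∀ᶠ s : ℂ in 𝓝 0,
      b + s • u ∈ ball a δ := fun b hb u ↦
    (Continuous.tendsto (by fun_prop : Continuous fun s : ℂ ↦ b + s • u) 0).eventually
      (isOpen_ball.eventually_mem (by simpa using hb))
  filter_upwards [hshift a (mem_ball_self hδ) (Pi.single j w)] with τ hτ
  rw [taylorTerm_pi_apply hU hf.1 m (hball hτ), taylorTerm_pi_apply hU hf.1 m ha, taylorTerm,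
    taylorTerm]
  congr 1
  refine Filter.EventuallyEq.iteratedDeriv_eq m ?_
  filter_upwards [hshift a (mem_ball_self hδ) v, hshift _ hτ v] with s h1 h2
  rw [add_right_comm, ← Pi.single_smul] at h2 ⊢
  exact hf.apply_add_single hU hball hij h1 h2

end CnHolo

theorem IsCompact.cthickening_subset_of_lt_infEDist_compl {X : Type*} [PseudoMetricSpace X]
    {U K : Set X} (hK : IsCompact K) {t : ℝ}
    (ht : ENNReal.ofReal t < ⨅ z ∈ K, Metric.infEDist z Uᶜ) : cthickening t K ⊆ U := by
  intro x hx
  rcases K.eq_empty_or_nonempty with rfl | hne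
  · simp at hx
  by_contra hxU
  obtain ⟨y, hy, hxy⟩ := hK.exists_infEDist_eq_edist hne x
  refine lt_irrefl (ENNReal.ofReal t) (ht.trans_le ?_)
  calc ⨅ z ∈ K, Metric.infEDist z Uᶜ ≤ Metric.infEDist y Uᶜ := iInf₂_le y hy
    _ ≤ edist y x := Metric.infEDist_le_edist_of_mem hxU
    _ = Metric.infEDist x K := by rw [edist_comm, hxy]
    _ ≤ ENNReal.ofReal t := hx

/-- The homogeneous parts of the Taylor expansion at a point of the hull satisfy the same
Cauchy estimates as those at the points of `K`. -/
theorem exists_norm_taylorTerm_le_of_mem_cnHull {n : ℕ} {l : Fin n → ℕ}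
    {U K : Set (∀ j, Fin (l j) → ℂ)} (hU : IsOpen U) (hK : IsCompact K)
    {a : ∀ j, Fin (l j) → ℂ} (ha : a ∈ cnHull U K)
    {f : (∀ j, Fin (l j) → ℂ) → (Fin n → ℂ)} (hf : CnHolo U f) {ρ t : ℝ} (hρ : 0 < ρ)
    (hρt : ρ < t) (ht : ENNReal.ofReal t < ⨅ z ∈ K, Metric.infEDist z Uᶜ) :
    ∃ M : ℝ, ∀ m v, ‖v‖ < ρ → ‖taylorTerm f m a v‖ ≤ M * (ρ / t) ^ m := by
  have htK := hK.cthickening_subset_of_lt_infEDist_compl ht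
  obtain ⟨M, hM⟩ := (hK.cthickening (r := t)).exists_bound_of_continuousOn
    (hf.1.continuousOn.mono htK)
  refine ⟨max M 0, fun m v hv ↦ (ha.2 _ (hf.taylorTerm_left hU m v)).trans ?_⟩
  have ht0 : 0 < t := hρ.trans hρt
  refine Real.sSup_le ?_ (by positivity)
  rintro _ ⟨w, hw, rfl⟩
  have hsub : closedBall w t ⊆ cthickening t K := closedBall_subset_cthickening hw t
  exact norm_taylorTerm_le hρ hρt
    (fun y hy ↦ hf.1.differentiableAt (hU.mem_nhds (htK (hsub hy))))
    (fun y hy ↦ (hM y (hsub hy)).trans (le_max_left _ _)) hv m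

/-- Let `r` be the distance from `K` to the complement of `U`. For every point
`a` of the hull of `K` and every `ℂⁿ`-holomorphic `f` on `U`, there is a
`ℂⁿ`-holomorphic function on the ball of radius `r` around `a` whose
derivatives of all orders agree with those of `f` at `a`. -/
theorem cnHolo_extend_on_ball {n : ℕ} {l : Fin n → ℕ}
    (U K : Set (∀ j, Fin (l j) → ℂ)) (hU : IsOpen U)
    (hKU : K ⊆ U) (hK : IsCompact K)
    (a : ∀ j, Fin (l j) → ℂ) (ha : a ∈ cnHull U K)
    (f : (∀ j, Fin (l j) → ℂ) → (Fin n → ℂ)) (hf : CnHolo U f) :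
    ∃ g, CnHolo (EMetric.ball a (⨅ z ∈ K, EMetric.infEdist z Uᶜ)) g ∧
      ∀ m : ℕ, iteratedFDeriv ℂ m f a = iteratedFDeriv ℂ m g a := by
  set g : (∀ j, Fin (l j) → ℂ) → (Fin n → ℂ) := fun z ↦ ∑' m, taylorTerm f m a (z - a)
  have key : ∀ z ∈ Metric.eball a (⨅ z ∈ K, Metric.infEDist z Uᶜ), ∃ δ > 0, ∃ u : ℕ → ℝ,
      Summable u ∧ ∀ m, ∀ y ∈ ball z δ, ‖taylorTerm f m a (y - a)‖ ≤ u m := by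
    intro z hz
    rw [Metric.mem_eball, edist_dist] at hz
    obtain ⟨t, hzt, ht⟩ := ENNReal.lt_iff_exists_nnreal_btwn.mp hz
    rw [← ENNReal.ofReal_coe_nnreal] at hzt ht
    have hzt' : dist z a < t := (ENNReal.ofReal_lt_ofReal_iff_of_nonneg dist_nonneg).mp hzt
    obtain ⟨ρ, hzρ, hρt⟩ := exists_between hzt'
    have hρ : 0 < ρ := dist_nonneg.trans_lt hzρ
    obtain ⟨M, hM⟩ := exists_norm_taylorTerm_le_of_mem_cnHull hU hK ha hf hρ hρt ht
    refine ⟨ρ - dist z a, sub_pos.mpr hzρ, fun m ↦ M * (ρ / t) ^ m, ?_, fun m y hy ↦ hM m _ ?_⟩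
    · exact (summable_geometric_of_lt_one (by positivity)
        ((div_lt_one (hρ.trans hρt)).mpr hρt)).mul_left M
    · rw [mem_ball] at hy
      rw [← dist_eq_norm]
      linarith [dist_triangle y z a]
  have hterm : ∀ m, Differentiable ℂ fun z ↦ taylorTerm f m a (z - a) := fun m ↦
    (differentiable_taylorTerm_right hU hf.1 m ha.1).comp (by fun_prop)
  have hgdiff : ∀ z ∈ Metric.eball a (⨅ z ∈ K, Metric.infEDist z Uᶜ), DifferentiableAt ℂ g z := by
    intro z hz
    obtain ⟨δ, hδ, u, hu, hbound⟩ := key z hz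
    exact (tendstoUniformlyOn_tsum hu hbound).differentiableAt_of_ball hδ
      (Eventually.of_forall fun s ↦
        (Differentiable.fun_sum fun m _ ↦ hterm m).differentiableOn)
  refine ⟨g, ⟨fun z hz ↦ (hgdiff z hz).differentiableWithinAt, fun z hz i j hij w ↦ ?_⟩,
    fun m ↦ ?_⟩
  · refine fderiv_apply_eq_zero_of_eventually_eq (differentiableAt_pi.mp (hgdiff z hz) i) ?_
    have hnear : ∀ᶠ y in 𝓝 z, y ∈ Metric.eball a (⨅ z ∈ K, Metric.infEDist z Uᶜ) :=
      Metric.isOpen_eball.eventually_mem hz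
    have happly : ∀ y ∈ Metric.eball a (⨅ z ∈ K, Metric.infEDist z Uᶜ),
        g y i = ∑' m, taylorTerm f m a (y - a) i := by
      intro y hy
      obtain ⟨δ, hδ, u, hu, hbound⟩ := key y hy
      exact tsum_apply (hu.of_norm_bounded fun m ↦ hbound m y (mem_ball_self hδ))
    have htendsto : Tendsto (fun τ : ℂ ↦ z + τ • (Pi.single j w : ∀ j, Fin (l j) → ℂ))
        (𝓝 0) (𝓝 z) := by
      simpa using
        Continuous.tendsto (f := fun τ : ℂ ↦ z + τ • (Pi.single j w : ∀ j, Fin (l j) → ℂ))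
          (by fun_prop) 0
    filter_upwards [htendsto.eventually hnear] with τ hτ
    rw [happly _ hτ, happly z hz]
    refine tsum_congr fun m ↦ ?_
    rw [add_sub_right_comm, ← Pi.single_smul]
    exact hf.taylorTerm_add_single_right hU m ha.1 _ hij _
  · obtain ⟨δ, hδ, hball⟩ := Metric.isOpen_iff.mp hU a ha.1
    have heq : f =ᶠ[𝓝 a] g := by
      filter_upwards [ball_mem_nhds a hδ] with z hz
      exact (hasSum_taylorTerm (hf.1.mono hball) hz).tsum_eq.symm
    exact (heq.iteratedFDeriv ℂ m).eq_of_nhds
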